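/- Let L be a proper continuous signature and let M be a continuous L-pre-structure with the Urysohn property. Let M̄ be any continuous L-structure that contains M as a substructure with M dense in M̄ (so M̄ is a completion of M). Then M̄ has the Urysohn property. -/

import Mathlib

namespace ContLogic

/-- A continuous signature with finitely many relation symbols, all of whose
moduli of continuity are nondecreasing. -/
structure Sig : Type 1 where
  I : Type
  finI : Finite I
  n : I → ℕ
  n_pos : ∀ i, 1 ≤ n i
  u : (i : I) → Fin (n i) → ℝ → ℝ
  u_zero : ∀ i j, u i j 0 = 0
  u_nonneg : ∀ i j t, 0 ≤ u i j t
  u_pos : ∀ i j t, 0 < t → 0 < u i j t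
  u_lim : ∀ i j, Filter.Tendsto (u i j) (nhdsWithin 0 (Set.Ioi 0)) (nhds 0)
  u_mono : ∀ i j, MonotoneOn (u i j) (Set.Ici 0)

/-- A continuous `L`-pre-structure: a metric space together with `[0,1]`-valued
relations respecting the moduli of continuity. -/
structure PreStr (L : Sig) : Type 1 where
  M : Type
  d : M → M → ℝ
  d_self : ∀ x, d x x = 0
  d_eq_zero : ∀ x y, d x y = 0 → x = y
  d_comm : ∀ x y, d x y = d y x
  d_triangle : ∀ x y z, d x z ≤ d x y + d y z
  R : (i : L.I) → (Fin (L.n i) → M) → ℝ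
  R_mem : ∀ i x, R i x ∈ Set.Icc (0 : ℝ) 1
  R_uc : ∀ (i : L.I) (j : Fin (L.n i)) (x y : Fin (L.n i) → M),
    (∀ k, k ≠ j → x k = y k) → |R i x - R i y| ≤ L.u i j (d (x j) (y j))

/-- The metric of `A` is complete (every Cauchy sequence converges). -/
def PreStr.IsComplete {L : Sig} (A : PreStr L) : Prop :=
  ∀ f : ℕ → A.M,
    (∀ ε : ℝ, 0 < ε → ∃ N : ℕ, ∀ m ≥ N, ∀ n ≥ N, A.d (f m) (f n) < ε) →
    ∃ x : A.M, ∀ ε : ℝ, 0 < ε → ∃ N : ℕ, ∀ n ≥ N, A.d (f n) x < ε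

/-- The metric of `A` is separable (there is a countable dense subset). -/
def PreStr.Separable {L : Sig} (A : PreStr L) : Prop :=
  ∃ D : Set A.M, D.Countable ∧ ∀ x : A.M, ∀ ε : ℝ, 0 < ε → ∃ y ∈ D, A.d x y < ε

/-- `f` is an isomorphic embedding of continuous `L`-pre-structures. -/
def Emb {L : Sig} (A B : PreStr L) (f : A.M → B.M) : Prop :=
  Function.Injective f ∧
  (∀ x y : A.M, B.d (f x) (f y) = A.d x y) ∧
  (∀ (i : L.I) (x : Fin (L.n i) → A.M), B.R i (f ∘ x) = A.R i x)

/-- The amalgamation property for a class `K` of continuous `L`-pre-structures. -/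
def HasAP {L : Sig} (K : PreStr L → Prop) : Prop :=
  ∀ (A P Q : PreStr L), K A → K P → K Q →
    ∀ (φ : A.M → P.M) (ψ : A.M → Q.M), Emb A P φ → Emb A Q ψ →
      ∃ (N : PreStr L) (ι : P.M → N.M) (τ : Q.M → N.M),
        K N ∧ Emb P N ι ∧ Emb Q N τ ∧ ι ∘ φ = τ ∘ ψ

/-- The strong amalgamation property for a class `K`. -/
def HasSAP {L : Sig} (K : PreStr L → Prop) : Prop :=
  ∀ (A P Q : PreStr L), K A → K P → K Q →
    ∀ (φ : A.M → P.M) (ψ : A.M → Q.M), Emb A P φ → Emb A Q ψ →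
      ∃ (N : PreStr L) (ι : P.M → N.M) (τ : Q.M → N.M),
        K N ∧ Emb P N ι ∧ Emb Q N τ ∧ ι ∘ φ = τ ∘ ψ ∧
        Set.range ι ∩ Set.range τ = Set.range (ι ∘ φ) ∧
        Set.range ι ∩ Set.range τ = Set.range (τ ∘ ψ)

/-- The joint embedding property for a class `K`. -/
def HasJEP {L : Sig} (K : PreStr L → Prop) : Prop :=
  ∀ A B : PreStr L, K A → K B →
    ∃ (C : PreStr L) (f : A.M → C.M) (g : B.M → C.M), K C ∧ Emb A C f ∧ Emb B C g

/-- `I_{i,j} = { r ≥ 0 : u_{i,j}(r) < 1 }`. -/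
def Sig.Ival (L : Sig) (i : L.I) (j : Fin (L.n i)) : Set ℝ :=
  {r : ℝ | 0 ≤ r ∧ L.u i j r < 1}

/-- `L` is semiproper. -/
def Sig.Semiproper (L : Sig) : Prop :=
  (∀ i j, BddAbove (L.Ival i j)) ∧
  (∀ i j, ∀ r s : ℝ, r ∈ L.Ival i j → s ∈ L.Ival i j → r + s ∈ L.Ival i j →
    L.u i j r + L.u i j s ≤ L.u i j (r + s)) ∧
  (∀ i : L.I, 2 ≤ L.n i → ∀ j, ∃ K : ℝ, 0 < K ∧ ∀ r ∈ L.Ival i j, L.u i j r = K * r)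

/-- `u` is upper semicontinuous on `J`. -/
def USCOn (u : ℝ → ℝ) (J : Set ℝ) : Prop :=
  ∀ x ∈ J, ∀ ε : ℝ, 0 < ε → ∃ δ : ℝ, 0 < δ ∧ ∀ x' ∈ J, |x' - x| < δ → u x' < u x + ε

/-- `L` is proper. -/
def Sig.Proper (L : Sig) : Prop :=
  L.Semiproper ∧ ∀ i j, USCOn (L.u i j) (L.Ival i j)

/-- `L` is strongly semiproper. -/
def Sig.StronglySemiproper (L : Sig) : Prop :=
  L.Semiproper ∧
  ∀ i : L.I, L.n i = 1 → ∀ j : Fin (L.n i), ∀ r₁ r₂ : ℝ, 0 < r₁ → 0 < r₂ →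
    r₁ + r₂ ∈ L.Ival i j →
    sInf (L.u i j '' Set.Ioi r₁) + sInf (L.u i j '' Set.Ioi r₂) ≤ L.u i j (r₁ + r₂)

/-- `L` is Lipschitz. -/
def Sig.Lipschitz (L : Sig) : Prop :=
  ∀ i j, BddAbove (L.Ival i j) ∧ ∃ K : ℝ, 0 < K ∧ ∀ r ∈ L.Ival i j, L.u i j r = K * r

/-- `B` is a one-point extension of `A` along the embedding `e`. -/
def OnePointExt {L : Sig} (A B : PreStr L) (e : A.M → B.M) : Prop :=
  Emb A B e ∧ ∃ x : B.M, x ∉ Set.range e ∧ ∀ y : B.M, y ∈ Set.range e ∨ y = x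

/-- `U` has the Urysohn property. -/
def HasUrysohn {L : Sig} (U : PreStr L) : Prop :=
  ∀ (A B : PreStr L) (e : A.M → B.M), Finite A.M → OnePointExt A B e →
    ∀ φ : A.M → U.M, Emb A U φ →
      ∃ ψ : B.M → U.M, Emb B U ψ ∧ ψ ∘ e = φ

/-- `Δ` is a distance value set. -/
def DistValueSet (Δ : Set ℝ) : Prop :=
  Δ ⊆ Set.Ioi 0 ∧
  ∀ a ∈ Δ, ∀ b ∈ Δ,
    (BddAbove Δ → min (a + b) (sSup Δ) ∈ Δ) ∧ (¬ BddAbove Δ → a + b ∈ Δ)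

/-- `(Δ, V)` is a good value pair for `L`. -/
def GoodPair (L : Sig) (Δ V : Set ℝ) : Prop :=
  DistValueSet Δ ∧ V ⊆ Set.Icc 0 1 ∧
  (BddAbove Δ → ∀ i j, 1 ≤ L.u i j (sSup Δ)) ∧
  (0 : ℝ) ∈ V ∧
  ∀ v ∈ V, ∀ δ ∈ Δ, ∀ i j, L.u i j δ < v → v - L.u i j δ ∈ V

/-- `A` is `(Δ, V)`-valued. -/
def Valued {L : Sig} (Δ V : Set ℝ) (A : PreStr L) : Prop :=
  (∀ x y : A.M, x ≠ y → A.d x y ∈ Δ) ∧ ∀ i x, A.R i x ∈ V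

/-- `U` has the `(Δ, V)`-Urysohn property. -/
def HasUrysohnRel {L : Sig} (Δ V : Set ℝ) (U : PreStr L) : Prop :=
  ∀ (A B : PreStr L) (e : A.M → B.M), Finite A.M →
    Valued Δ V A → Valued Δ V B → OnePointExt A B e →
    ∀ φ : A.M → U.M, Emb A U φ →
      ∃ ψ : B.M → U.M, Emb B U ψ ∧ ψ ∘ e = φ

/-- `f` is an automorphism of `A`. -/
def Aut {L : Sig} (A : PreStr L) (f : A.M → A.M) : Prop :=
  Function.Bijective f ∧ Emb A A f

/-- `f` restricted to `S` is a partial isomorphism of `A`. -/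
def PartIso {L : Sig} (A : PreStr L) (S : Set A.M) (f : A.M → A.M) : Prop :=
  Set.InjOn f S ∧
  (∀ x ∈ S, ∀ y ∈ S, A.d (f x) (f y) = A.d x y) ∧
  ∀ (i : L.I) (x : Fin (L.n i) → A.M), (∀ k, x k ∈ S) → A.R i (f ∘ x) = A.R i x

/-- `act` is an action of the group `Γ` on `A` by automorphisms. -/
def IsActionByAut (L : Sig) (Γ : Type) (gΓ : Group Γ) (A : PreStr L)
    (act : Γ → A.M → A.M) : Prop :=
  letI := gΓ
  (∀ x, act 1 x = x) ∧ (∀ g h x, act (g * h) x = act g (act h x)) ∧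
  ∀ g : Γ, Aut A (act g)

/-- `(e, f)` is an embedding from the action `actA : Λ ↷ A` to `actB : Γ ↷ B`. -/
def ActEmb (L : Sig) (Λ Γ : Type) (gΛ : Group Λ) (gΓ : Group Γ)
    (A B : PreStr L) (actA : Λ → A.M → A.M) (actB : Γ → B.M → B.M)
    (e : Λ → Γ) (f : A.M → B.M) : Prop :=
  letI := gΛ
  letI := gΓ
  Function.Injective e ∧ (∀ g h : Λ, e (g * h) = e g * e h) ∧
  Emb A B f ∧ ∀ (g : Λ) (x : A.M), actB (e g) (f x) = f (actA g x)

theorem PreStr.d_nonneg {L : Sig} (A : PreStr L) (x y : A.M) : 0 ≤ A.d x y := by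
  have h := A.d_triangle x y x
  rw [A.d_self, A.d_comm y x] at h
  linarith

/-- The relations and the distance of a pre-structure, without the requirement that distinct
points have positive distance. -/
structure PseudoStr (L : Sig) (X : Type) where
  d : X → X → ℝ
  d_self : ∀ x, d x x = 0
  d_comm : ∀ x y, d x y = d y x
  d_triangle : ∀ x y z, d x z ≤ d x y + d y z
  R : (i : L.I) → (Fin (L.n i) → X) → ℝ
  R_mem : ∀ i x, R i x ∈ Set.Icc (0 : ℝ) 1
  R_uc : ∀ (i : L.I) (j : Fin (L.n i)) (x y : Fin (L.n i) → X),
    (∀ k, k ≠ j → x k = y k) → |R i x - R i y| ≤ L.u i j (d (x j) (y j))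

/-- A pre-structure, viewed as a pseudo-structure on its domain. -/
def PreStr.toPseudo {L : Sig} (A : PreStr L) : PseudoStr L A.M where
  d := A.d
  d_self := A.d_self
  d_comm := A.d_comm
  d_triangle := A.d_triangle
  R := A.R
  R_mem := A.R_mem
  R_uc := A.R_uc

/-- The pre-structure pulled back along a map that separates points. -/
def PseudoStr.comap {L : Sig} {X T : Type} (N : PseudoStr L X) (f : T → X)
    (hf : ∀ a b, N.d (f a) (f b) = 0 → a = b) : PreStr L where
  M := T
  d a b := N.d (f a) (f b)
  d_self _ := N.d_self _
  d_eq_zero := hf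
  d_comm _ _ := N.d_comm _ _
  d_triangle _ _ _ := N.d_triangle _ _ _
  R i x := N.R i (f ∘ x)
  R_mem _ _ := N.R_mem _ _
  R_uc i j x y h := N.R_uc i j (f ∘ x) (f ∘ y) fun k hk => congrArg f (h k hk)

/-- The substructure of a pre-structure parametrized by an injective map. -/
def PreStr.comap {L : Sig} (A : PreStr L) {T : Type} (f : T → A.M)
    (hf : Function.Injective f) : PreStr L :=
  A.toPseudo.comap f fun _ _ h => hf (A.d_eq_zero _ _ h)

theorem PseudoStr.d_nonneg {L : Sig} {X : Type} (N : PseudoStr L X) (x y : X) :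
    0 ≤ N.d x y := by
  have h := N.d_triangle x y x
  rw [N.d_self, N.d_comm y x] at h
  linarith

/-- A function of several variables that is controlled in each variable separately is controlled
by the sum. -/
theorem abs_sub_le_sum_of_coord {n : ℕ} {X : Type} (f : (Fin n → X) → ℝ)
    (c : Fin n → X → X → ℝ)
    (h : ∀ (j : Fin n) (x y : Fin n → X), (∀ k, k ≠ j → x k = y k) →
      |f x - f y| ≤ c j (x j) (y j)) (x y : Fin n → X) :
    |f x - f y| ≤ ∑ j, c j (x j) (y j) := by
  classical
  have key : ∀ s : Finset (Fin n), |f x - f (s.piecewise y x)| ≤ ∑ j ∈ s, c j (x j) (y j) := by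
    intro s
    induction s using Finset.induction_on with
    | empty => simp
    | insert a s ha ih =>
      have h1 := h a (s.piecewise y x) ((insert a s).piecewise y x) (by
        intro k hk
        simp [Finset.piecewise, hk])
      have h2 : s.piecewise y x a = x a := by simp [Finset.piecewise, ha]
      have h3 : (insert a s).piecewise y x a = y a := by simp
      rw [h2, h3] at h1
      rw [Finset.sum_insert ha]
      have := abs_sub_le (f x) (f (s.piecewise y x)) (f ((insert a s).piecewise y x))
      linarith
  simpa using key Finset.univ

theorem PseudoStr.abs_R_sub_le_sum {L : Sig} {X : Type} (N : PseudoStr L X) (i : L.I)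
    (x y : Fin (L.n i) → X) :
    |N.R i x - N.R i y| ≤ ∑ j, L.u i j (N.d (x j) (y j)) :=
  abs_sub_le_sum_of_coord (N.R i) (fun j a b => L.u i j (N.d a b)) (N.R_uc i) x y

/-- McShane extension of a partial `[0,1]`-valued 1-Lipschitz function. -/
theorem exists_lipschitz_extension {X J : Type} [Nonempty J] (ρ : X → X → ℝ)
    (ρ_self : ∀ x, ρ x x = 0) (ρ_nonneg : ∀ x y, 0 ≤ ρ x y) (ρ_comm : ∀ x y, ρ x y = ρ y x)
    (ρ_triangle : ∀ x y z, ρ x z ≤ ρ x y + ρ y z) (p : J → X) (v : J → ℝ)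
    (hv : ∀ a, v a ∈ Set.Icc (0 : ℝ) 1) (h : ∀ a b, v b ≤ v a + ρ (p a) (p b)) :
    ∃ f : X → ℝ, (∀ a, f (p a) = v a) ∧ (∀ x, f x ∈ Set.Icc (0 : ℝ) 1) ∧
      ∀ x y, |f x - f y| ≤ ρ x y := by
  have nonneg : ∀ x a, 0 ≤ min 1 (v a + ρ (p a) x) := fun x a =>
    le_min zero_le_one (add_nonneg (hv a).1 (ρ_nonneg _ _))
  have bdd : ∀ x, BddBelow (Set.range fun a => min 1 (v a + ρ (p a) x)) := fun x =>
    ⟨0, by rintro _ ⟨a, rfl⟩; exact nonneg x a⟩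
  have lip : ∀ x y, (⨅ a, min 1 (v a + ρ (p a) x)) - ρ x y ≤ ⨅ a, min 1 (v a + ρ (p a) y) := by
    intro x y
    refine le_ciInf fun a => ?_
    have h1 := ciInf_le (bdd x) a
    have h2 := ρ_triangle (p a) y x
    have h3 := ρ_comm x y
    have h4 := ρ_nonneg x y
    have h5 := min_le_left (1 : ℝ) (v a + ρ (p a) x)
    have h6 := min_le_right (1 : ℝ) (v a + ρ (p a) x)
    exact le_min (by linarith) (by linarith)
  refine ⟨fun x => ⨅ a, min 1 (v a + ρ (p a) x), fun b => le_antisymm ?_ ?_, fun x => ⟨?_, ?_⟩, ?_⟩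
  · refine (ciInf_le (bdd _) b).trans ((min_le_right _ _).trans ?_)
    rw [ρ_self, add_zero]
  · exact le_ciInf fun a => le_min (hv b).2 (h a b)
  · exact le_ciInf (nonneg x)
  · exact (ciInf_le (bdd x) (Classical.arbitrary J)).trans (min_le_left _ _)
  · intro x y
    have h1 := lip x y
    have h2 := lip y x
    rw [ρ_comm y x] at h2
    exact abs_le.2 ⟨by linarith, by linarith⟩

theorem abs_sub_le_one {a b : ℝ} (ha : a ∈ Set.Icc (0 : ℝ) 1) (hb : b ∈ Set.Icc (0 : ℝ) 1) :
    |a - b| ≤ 1 :=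
  abs_le.2 ⟨by linarith [ha.1, hb.2], by linarith [ha.2, hb.1]⟩

/-- Each modulus is superadditive as long as its values are below `1`. -/
def Sig.TruncSuperadditive (L : Sig) : Prop :=
  ∀ i j r s, 0 ≤ r → 0 ≤ s → L.u i j r + L.u i j s ≤ L.u i j (r + s) ∨ 1 ≤ L.u i j (r + s)

/-- For relations of arity at least two, each modulus is linear until its value reaches `1`,
without a jump at the end. -/
def Sig.TruncLinear (L : Sig) : Prop :=
  ∀ i, 2 ≤ L.n i → ∀ j, ∃ K : ℝ, 0 < K ∧
    ∀ r, 0 ≤ r → L.u i j r = K * r ∨ (1 ≤ L.u i j r ∧ 1 ≤ K * r)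

theorem Sig.Semiproper.truncSuperadditive {L : Sig} (h : L.Semiproper) :
    L.TruncSuperadditive := by
  intro i j r s hr hs
  by_cases h1 : L.u i j (r + s) < 1
  · left
    have hrs : 0 ≤ r + s := add_nonneg hr hs
    refine h.2.1 i j r s ⟨hr, lt_of_le_of_lt ?_ h1⟩ ⟨hs, lt_of_le_of_lt ?_ h1⟩ ⟨hrs, h1⟩
    · exact L.u_mono i j hr hrs (by linarith)
    · exact L.u_mono i j hs hrs (by linarith)
  · exact Or.inr (not_lt.1 h1)

/-- Two pre-structures can be glued along an approximate embedding `g` with error function `δ`,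
so that each `g b` is at distance at most `δ b` from `b`. -/
theorem exists_amalgam {L : Sig} (hS : L.TruncSuperadditive) (hK : L.TruncLinear)
    (Y B : PreStr L) [Finite B.M] [Nonempty B.M] (g : B.M → Y.M) (δ : B.M → ℝ)
    (hd : ∀ b b', |Y.d (g b) (g b') - B.d b b'| ≤ δ b + δ b')
    (hR : ∀ i (q : Fin (L.n i) → B.M), ∃ j, |Y.R i (g ∘ q) - B.R i q| ≤ L.u i j (δ (q j))) :
    ∃ N : PseudoStr L (Y.M ⊕ B.M),
      (∀ w w', N.d (Sum.inl w) (Sum.inl w') = Y.d w w') ∧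
      (∀ b b', N.d (Sum.inr b) (Sum.inr b') = B.d b b') ∧
      (∀ w b, ∃ b', N.d (Sum.inl w) (Sum.inr b) = Y.d w (g b') + δ b' + B.d b' b) ∧
      (∀ b, N.d (Sum.inl (g b)) (Sum.inr b) ≤ δ b) ∧
      (∀ i t, N.R i (Sum.inl ∘ t) = Y.R i t) ∧
      (∀ i q, N.R i (Sum.inr ∘ q) = B.R i q) := by
  have hδ : ∀ b, 0 ≤ δ b := fun b => by
    have h := hd b b
    rw [Y.d_self, B.d_self, sub_self, abs_zero] at h
    linarith
  obtain ⟨D, hD, hD'⟩ : ∃ D : Y.M → B.M → ℝ,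
      (∀ w b, ∃ b', D w b = Y.d w (g b') + δ b' + B.d b' b) ∧
      (∀ w b b', D w b ≤ Y.d w (g b') + δ b' + B.d b' b) := by
    refine ⟨fun w b => ⨅ b', (Y.d w (g b') + δ b' + B.d b' b), fun w b => ?_, fun w b b' => ?_⟩
    · obtain ⟨b', hb'⟩ := exists_eq_ciInf_of_finite
        (f := fun b' => Y.d w (g b') + δ b' + B.d b' b)
      exact ⟨b', hb'.symm⟩
    · exact ciInf_le (Set.finite_range _).bddBelow b'
  have hD0 : ∀ w b, 0 ≤ D w b := fun w b => by
    obtain ⟨c, hc⟩ := hD w b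
    have := Y.d_nonneg w (g c)
    have := B.d_nonneg c b
    linarith [hδ c]
  have tri1 : ∀ w w' b, D w b ≤ Y.d w w' + D w' b := fun w w' b => by
    obtain ⟨c, hc⟩ := hD w' b
    have := hD' w b c
    have := Y.d_triangle w w' (g c)
    linarith
  have tri2 : ∀ w b b', D w b ≤ D w b' + B.d b' b := fun w b b' => by
    obtain ⟨c, hc⟩ := hD w b'
    have := hD' w b c
    have := B.d_triangle c b' b
    linarith
  have tri3 : ∀ w w' b, Y.d w w' ≤ D w b + D w' b := fun w w' b => by
    obtain ⟨c, hc⟩ := hD w b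
    obtain ⟨c', hc'⟩ := hD w' b
    have h1 := Y.d_triangle w (g c) w'
    have h2 := Y.d_triangle (g c) (g c') w'
    have h3 := B.d_triangle c b c'
    have h4 := (abs_le.1 (hd c c')).2
    rw [Y.d_comm (g c') w'] at h2
    rw [B.d_comm b c'] at h3
    linarith
  have tri4 : ∀ w b b', B.d b b' ≤ D w b + D w b' := fun w b b' => by
    obtain ⟨c, hc⟩ := hD w b
    obtain ⟨c', hc'⟩ := hD w b'
    have h1 := B.d_triangle b c b'
    have h2 := B.d_triangle c c' b'
    have h3 := Y.d_triangle (g c) w (g c')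
    have h4 := (abs_le.1 (hd c c')).1
    rw [Y.d_comm (g c) w] at h3
    rw [B.d_comm b c] at h1
    linarith
  let dN : Y.M ⊕ B.M → Y.M ⊕ B.M → ℝ := fun x y =>
    Sum.elim (fun w => Sum.elim (fun w' => Y.d w w') (fun b => D w b) y)
      (fun b => Sum.elim (fun w => D w b) (fun b' => B.d b b') y) x
  have dN_self : ∀ x, dN x x = 0 := by
    rintro (x | x)
    · exact Y.d_self x
    · exact B.d_self x
  have dN_comm : ∀ x y, dN x y = dN y x := by
    rintro (x | x) (y | y)
    · exact Y.d_comm x y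
    · rfl
    · rfl
    · exact B.d_comm x y
  have dN_triangle : ∀ x y z, dN x z ≤ dN x y + dN y z := by
    rintro (x | x) (y | y) (z | z)
    · exact Y.d_triangle x y z
    · exact tri1 x y z
    · exact tri3 x z y
    · exact tri2 x z y
    · have := tri1 z y x
      rw [Y.d_comm, add_comm] at this
      exact this
    · exact tri4 y x z
    · have := tri2 z x y
      rw [B.d_comm, add_comm] at this
      exact this
    · exact B.d_triangle x y z
  have dN_nonneg : ∀ x y, 0 ≤ dN x y := by
    rintro (x | x) (y | y)
    · exact Y.d_nonneg x y
    · exact hD0 x y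
    · exact hD0 y x
    · exact B.d_nonneg x y
  have relations : ∀ i, ∃ f : (Fin (L.n i) → Y.M ⊕ B.M) → ℝ,
      (∀ x, f x ∈ Set.Icc (0 : ℝ) 1) ∧
      (∀ (j : Fin (L.n i)) (x y : Fin (L.n i) → Y.M ⊕ B.M), (∀ k, k ≠ j → x k = y k) →
        |f x - f y| ≤ L.u i j (dN (x j) (y j))) ∧
      (∀ t, f (Sum.inl ∘ t) = Y.R i t) ∧ (∀ q, f (Sum.inr ∘ q) = B.R i q) := by
    intro i
    rcases (L.n_pos i).eq_or_lt with h1 | h2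
    · have : Subsingleton (Fin (L.n i)) := by rw [← h1]; infer_instance
      have cross : ∀ j w b, |Y.R i (fun _ => w) - B.R i (fun _ => b)| ≤ L.u i j (D w b) := by
        intro j w b
        have le_one := abs_sub_le_one (Y.R_mem i fun _ => w) (B.R_mem i fun _ => b)
        obtain ⟨c, hc⟩ := hD w b
        obtain ⟨j', hj'⟩ := hR i (fun _ => c)
        obtain rfl := Subsingleton.elim j' j
        have e1 := Y.R_uc i j' (fun _ => w) (fun _ => g c)
          fun k hk => absurd (Subsingleton.elim k j') hk
        have e2 := B.R_uc i j' (fun _ => c) (fun _ => b)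
          fun k hk => absurd (Subsingleton.elim k j') hk
        have e3 : Y.R i (g ∘ fun _ => c) = Y.R i (fun _ => g c) := rfl
        rw [e3] at hj'
        rw [hc]
        rcases hS i j' _ _ (add_nonneg (Y.d_nonneg w (g c)) (hδ c)) (B.d_nonneg c b) with h | h
        swap
        · exact le_one.trans h
        rcases hS i j' _ _ (Y.d_nonneg w (g c)) (hδ c) with h' | h'
        swap
        · refine le_one.trans (h'.trans (le_trans ?_ h))
          linarith [L.u_nonneg i j' (B.d c b)]
        have t1 := abs_sub_le (Y.R i fun _ => w) (Y.R i fun _ => g c) (B.R i fun _ => b)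
        have t2 := abs_sub_le (Y.R i fun _ => g c) (B.R i fun _ => c) (B.R i fun _ => b)
        linarith
      let j₀ : Fin (L.n i) := ⟨0, L.n_pos i⟩
      refine ⟨fun x => Sum.elim (fun w => Y.R i fun _ => w) (fun b => B.R i fun _ => b) (x j₀),
        fun x => ?_, fun j x y _ => ?_, fun t => ?_, fun q => ?_⟩
      · show Sum.elim _ _ (x j₀) ∈ _
        rcases x j₀ with w | b
        · exact Y.R_mem i _
        · exact B.R_mem i _
      · obtain rfl := Subsingleton.elim j₀ j
        show |Sum.elim _ _ (x j₀) - Sum.elim _ _ (y j₀)| ≤ _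
        rcases x j₀ with w | b <;> rcases y j₀ with w' | b'
        · exact Y.R_uc i j₀ (fun _ => w) (fun _ => w')
            fun k hk => absurd (Subsingleton.elim k j₀) hk
        · exact cross j₀ w b'
        · have := cross j₀ w' b
          rw [abs_sub_comm] at this
          exact this
        · exact B.R_uc i j₀ (fun _ => b) (fun _ => b')
            fun k hk => absurd (Subsingleton.elim k j₀) hk
      · exact congrArg (Y.R i) (funext fun k => congrArg t (Subsingleton.elim j₀ k))
      · exact congrArg (B.R i) (funext fun k => congrArg q (Subsingleton.elim j₀ k))
    · choose K hK0 hKu using hK i h2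
      have toK : ∀ (a b : ℝ) j r, 0 ≤ r → |a - b| ≤ 1 → |a - b| ≤ L.u i j r →
          |a - b| ≤ K j * r := by
        intro a b j r hr h1 h
        rcases hKu j r hr with h' | h'
        · rwa [h'] at h
        · exact h1.trans h'.2
      have lipY : ∀ x y, |Y.R i x - Y.R i y| ≤ ∑ j, K j * Y.d (x j) (y j) :=
        abs_sub_le_sum_of_coord (Y.R i) (fun j a b => K j * Y.d a b) fun j x y h =>
          toK _ _ j _ (Y.d_nonneg _ _) (abs_sub_le_one (Y.R_mem i x) (Y.R_mem i y))
            (Y.R_uc i j x y h)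
      have lipB : ∀ x y, |B.R i x - B.R i y| ≤ ∑ j, K j * B.d (x j) (y j) :=
        abs_sub_le_sum_of_coord (B.R i) (fun j a b => K j * B.d a b) fun j x y h =>
          toK _ _ j _ (B.d_nonneg _ _) (abs_sub_le_one (B.R_mem i x) (B.R_mem i y))
            (B.R_uc i j x y h)
      have lipg : ∀ q, |Y.R i (g ∘ q) - B.R i q| ≤ ∑ j, K j * δ (q j) := by
        intro q
        obtain ⟨j, hj⟩ := hR i q
        refine (toK _ _ j _ (hδ _) (abs_sub_le_one (Y.R_mem _ _) (B.R_mem _ _)) hj).trans ?_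
        exact Finset.single_le_sum (f := fun j => K j * δ (q j))
          (fun k _ => mul_nonneg (hK0 k).le (hδ _)) (Finset.mem_univ j)
      have cross : ∀ t q, |Y.R i t - B.R i q| ≤ ∑ j, K j * D (t j) (q j) := by
        intro t q
        choose c hc using fun j => hD (t j) (q j)
        have e : ∑ j, K j * D (t j) (q j) =
            ∑ j, K j * Y.d (t j) ((g ∘ c) j) + ∑ j, K j * δ (c j) +
              ∑ j, K j * B.d (c j) (q j) := by
          rw [← Finset.sum_add_distrib, ← Finset.sum_add_distrib]
          refine Finset.sum_congr rfl fun j _ => ?_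
          rw [hc j, mul_add, mul_add]
          rfl
        rw [e]
        have t1 := abs_sub_le (Y.R i t) (Y.R i (g ∘ c)) (B.R i q)
        have t2 := abs_sub_le (Y.R i (g ∘ c)) (B.R i c) (B.R i q)
        linarith [lipY t (g ∘ c), lipg c, lipB c q]
      let ρ : (Fin (L.n i) → Y.M ⊕ B.M) → (Fin (L.n i) → Y.M ⊕ B.M) → ℝ :=
        fun x y => ∑ j, K j * dN (x j) (y j)
      obtain ⟨f, hf, hf01, hfl⟩ := exists_lipschitz_extension
        (J := (Fin (L.n i) → Y.M) ⊕ (Fin (L.n i) → B.M)) ρ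
        (fun x => Finset.sum_eq_zero fun j _ => by rw [dN_self, mul_zero])
        (fun x y => Finset.sum_nonneg fun j _ => mul_nonneg (hK0 j).le (dN_nonneg _ _))
        (fun x y => Finset.sum_congr rfl fun j _ => by rw [dN_comm])
        (fun x y z => by
          show ∑ j, _ ≤ ∑ j, _ + ∑ j, _
          rw [← Finset.sum_add_distrib]
          refine Finset.sum_le_sum fun j _ => ?_
          rw [← mul_add]
          exact mul_le_mul_of_nonneg_left (dN_triangle _ _ _) (hK0 j).le)
        (Sum.elim (fun t => Sum.inl ∘ t) (fun q => Sum.inr ∘ q))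
        (Sum.elim (Y.R i) (B.R i))
        (by
          rintro (t | q)
          · exact Y.R_mem i t
          · exact B.R_mem i q)
        (by
          rintro (t | t) (q | q)
          · show Y.R i q ≤ Y.R i t + ∑ j, K j * Y.d (t j) (q j)
            linarith [(abs_le.1 (lipY t q)).1]
          · show B.R i q ≤ Y.R i t + ∑ j, K j * D (t j) (q j)
            linarith [(abs_le.1 (cross t q)).1]
          · show Y.R i q ≤ B.R i t + ∑ j, K j * D (q j) (t j)
            linarith [(abs_le.1 (cross q t)).2]
          · show B.R i q ≤ B.R i t + ∑ j, K j * B.d (t j) (q j)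
            linarith [(abs_le.1 (lipB t q)).1])
      refine ⟨f, hf01, fun j x y h => ?_, fun t => hf (Sum.inl t), fun q => hf (Sum.inr q)⟩
      have h1 := hfl x y
      have h2 : ρ x y = K j * dN (x j) (y j) :=
        Finset.sum_eq_single j (fun k _ hk => by rw [h k hk, dN_self, mul_zero])
          fun hj => absurd (Finset.mem_univ j) hj
      rw [h2] at h1
      rcases hKu j _ (dN_nonneg (x j) (y j)) with h' | h'
      · rwa [h']
      · exact (abs_sub_le_one (hf01 x) (hf01 y)).trans h'.1
  choose f hf01 hfuc hfY hfB using relations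
  refine ⟨⟨dN, dN_self, dN_comm, dN_triangle, f, hf01, hfuc⟩, fun _ _ => rfl, fun _ _ => rfl,
    hD, fun b => ?_, hfY, hfB⟩
  have h := hD' (g b) b b
  rw [Y.d_self, B.d_self, zero_add, add_zero] at h
  exact h

open Classical in
/-- The three-point structure with distance `r` between `0` and `1`, distance `ρ` from `2` to the
other points, and relations given by the indicator function of `T`. -/
noncomputable def threePoint (L : Sig) (r ρ : ℝ) (hr : 0 < r) (hρ : r ≤ 2 * ρ)
    (T : Set (Σ i : L.I, Fin (L.n i) → Fin 3))
    (hT : ∀ (i : L.I) (j : Fin (L.n i)) (x y : Fin (L.n i) → Fin 3),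
      (∀ k, k ≠ j → x k = y k) → ⟨i, x⟩ ∈ T → ⟨i, y⟩ ∉ T →
      1 ≤ L.u i j (if x j = y j then 0 else if x j = 2 ∨ y j = 2 then ρ else r)) :
    PreStr L where
  M := Fin 3
  d x y := if x = y then 0 else if x = 2 ∨ y = 2 then ρ else r
  d_self x := if_pos rfl
  d_eq_zero x y h := by
    by_contra hne
    rw [if_neg hne] at h
    split_ifs at h <;> linarith
  d_comm x y := by simp only [eq_comm, or_comm]
  d_triangle x y z := by
    fin_cases x <;> fin_cases y <;> fin_cases z <;> simp <;> linarith
  R i x := if ⟨i, x⟩ ∈ T then 1 else 0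
  R_mem i x := by
    split_ifs <;> simp
  R_uc i j x y h := by
    by_cases hx : (⟨i, x⟩ : Σ i : L.I, Fin (L.n i) → Fin 3) ∈ T <;>
      by_cases hy : (⟨i, y⟩ : Σ i : L.I, Fin (L.n i) → Fin 3) ∈ T
    · simpa [hx, hy] using L.u_nonneg _ _ _
    · simpa [hx, hy] using hT i j x y h hx hy
    · have := hT i j y x (fun k hk => (h k hk).symm) hy hx
      simp only [eq_comm (a := y j) (b := x j), or_comm (a := y j = 2)] at this
      simpa [hx, hy] using this
    · simpa [hx, hy] using L.u_nonneg _ _ _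

/-- A pre-structure with the Urysohn property contains a copy of every finite pre-structure. -/
theorem HasUrysohn.exists_emb {L : Sig} {U : PreStr L} (hU : HasUrysohn U) (B : PreStr L) :
    ∀ (n : ℕ) (f : Fin n → B.M) (hf : Function.Injective f),
      ∃ φ : Fin n → U.M, Emb (B.comap f hf) U φ := by
  intro n
  induction n with
  | zero =>
    intro f hf
    exact ⟨Fin.elim0, fun x => x.elim0, fun x => x.elim0,
      fun i x => (x ⟨0, L.n_pos i⟩).elim0⟩
  | succ n ih =>
    intro f hf
    obtain ⟨φ, hφ⟩ := ih (f ∘ Fin.castSucc) (hf.comp (Fin.castSucc_injective n))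
    obtain ⟨ψ, hψ, -⟩ := hU (B.comap (f ∘ Fin.castSucc) (hf.comp (Fin.castSucc_injective n)))
      (B.comap f hf) Fin.castSucc (inferInstanceAs (Finite (Fin n)))
      ⟨⟨Fin.castSucc_injective n, fun _ _ => rfl, fun _ _ => rfl⟩, Fin.last n, by
        rintro ⟨x, hx⟩
        exact (Fin.castSucc_lt_last x).ne hx, fun y => by
        induction y using Fin.lastCases with
        | last => exact Or.inr rfl
        | cast x => exact Or.inl ⟨x, rfl⟩⟩ φ hφ
    exact ⟨ψ, hψ⟩

theorem Sig.Semiproper.eventually_one_le {L : Sig} (h : L.Semiproper) :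
    ∀ᶠ C in Filter.atTop, ∀ i j, 1 ≤ L.u i j C := by
  have := L.finI
  refine Filter.eventually_all.2 fun i => Filter.eventually_all.2 fun j => ?_
  obtain ⟨b, hb⟩ := h.1 i j
  filter_upwards [Filter.eventually_gt_atTop b, Filter.eventually_ge_atTop 0] with C h1 h2
  by_contra hlt
  exact (hb ⟨h2, not_le.1 hlt⟩).not_gt h1

theorem HasUrysohn.truncLinear {L : Sig} (hL : L.Semiproper) {U : PreStr L}
    (hU : HasUrysohn U) : L.TruncLinear := by
  intro i hi j
  obtain ⟨K, hK0, hK⟩ := hL.2.2 i hi j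
  refine ⟨K, hK0, fun r hr => ?_⟩
  by_cases hu : L.u i j r < 1
  · exact Or.inl (hK r ⟨hr, hu⟩)
  refine Or.inr ⟨not_lt.1 hu, ?_⟩
  by_contra! hKr
  obtain ⟨s, hs0, hus, hus2, hKs⟩ : ∃ s, 0 < s ∧ 1 ≤ L.u i j s ∧ L.u i j (s / 2) < 1 ∧
      K * s < 1 := by
    have hr0 : 0 < r := by
      refine hr.lt_of_ne fun h => hu ?_
      rw [← h, L.u_zero]
      exact one_pos
    have hex : ∃ m : ℕ, L.u i j (r / 2 ^ m) < 1 := by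
      have ht : Filter.Tendsto (fun m : ℕ => r / 2 ^ m) Filter.atTop
          (nhdsWithin 0 (Set.Ioi 0)) := by
        refine tendsto_nhdsWithin_iff.2 ⟨?_, Filter.Eventually.of_forall fun m => ?_⟩
        · simpa [div_eq_mul_inv] using
            (tendsto_pow_atTop_nhds_zero_of_lt_one (by norm_num : (0 : ℝ) ≤ 2⁻¹)
              (by norm_num)).const_mul r
        · exact div_pos hr0 (by positivity)
      exact (((L.u_lim i j).comp ht).eventually_lt_const one_pos).exists
    classical
    obtain ⟨m, hm⟩ : ∃ m, Nat.find hex = m + 1 := by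
      refine Nat.exists_eq_succ_of_ne_zero fun h0 => hu ?_
      have := Nat.find_spec hex
      rwa [h0, pow_zero, div_one] at this
    have h1 := Nat.find_spec hex
    have h2 := Nat.find_min hex (m := m) (by omega)
    rw [hm, pow_succ, ← div_div] at h1
    have h3 : r / 2 ^ m ≤ r := div_le_self hr (one_le_pow₀ one_le_two)
    exact ⟨r / 2 ^ m, by positivity, not_lt.1 h2, h1,
      lt_of_le_of_lt (mul_le_mul_of_nonneg_left h3 hK0.le) hKr⟩
  obtain ⟨ρ, hρs, hρ⟩ := ((Filter.eventually_ge_atTop s).and hL.eventually_one_le).exists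
  obtain ⟨j', hj'⟩ : ∃ j' : Fin (L.n i), j' ≠ j := by
    have : Nontrivial (Fin (L.n i)) := Fin.nontrivial_iff_two_le.2 hi
    exact exists_ne j
  let t : Fin (L.n i) → Fin 3 := Function.update (fun _ => 2) j 1
  let P : PreStr L := threePoint L s ρ hs0 (by linarith) {⟨i, t⟩} (by
    rintro i' k x y hxy hx hy
    obtain ⟨rfl, hx'⟩ := Sigma.mk.inj_iff.1 (Set.mem_singleton_iff.1 hx)
    obtain rfl := eq_of_heq hx'
    have hne : t k ≠ y k := by
      intro hk
      refine hy (Set.mem_singleton_iff.2 ?_)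
      congr 1
      funext l
      by_cases hl : l = k
      · rw [hl, hk]
      · exact (hxy l hl).symm
    rw [if_neg hne]
    by_cases hkj : k = j
    · subst hkj
      split_ifs
      · exact hρ _ _
      · exact hus
    · have : t k = 2 := Function.update_of_ne hkj _ _
      rw [if_pos (Or.inl this)]
      exact hρ _ _)
  let Q : PreStr L := threePoint L s (s / 2) hs0 (by linarith) ∅
    (fun _ _ _ _ _ h => absurd h (Set.notMem_empty _))
  have hinj := Fin.castSucc_injective 2
  obtain ⟨φ, hφ⟩ := hU.exists_emb P 2 Fin.castSucc hinj
  have hnew : Fin.last 2 ∉ Set.range (Fin.castSucc : Fin 2 → Fin 3) := by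
    rintro ⟨x, hx⟩
    exact (Fin.castSucc_lt_last x).ne hx
  have hall : ∀ y : Fin 3, y ∈ Set.range (Fin.castSucc : Fin 2 → Fin 3) ∨ y = Fin.last 2 := by
    intro y
    induction y using Fin.lastCases with
    | last => exact Or.inr rfl
    | cast x => exact Or.inl ⟨x, rfl⟩
  obtain ⟨ψ, hψ, hψφ⟩ := hU (P.comap Fin.castSucc hinj) P Fin.castSucc
    (inferInstanceAs (Finite (Fin 2)))
    ⟨⟨hinj, fun _ _ => rfl, fun _ _ => rfl⟩, Fin.last 2, hnew, hall⟩ φ hφ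
  obtain ⟨χ, hχ, hχφ⟩ := hU (P.comap Fin.castSucc hinj) Q Fin.castSucc
    (inferInstanceAs (Finite (Fin 2))) ⟨⟨hinj, fun x y => by
        show (if Fin.castSucc x = Fin.castSucc y then (0 : ℝ) else
            if Fin.castSucc x = 2 ∨ Fin.castSucc y = 2 then s / 2 else s) =
          (if Fin.castSucc x = Fin.castSucc y then (0 : ℝ) else
            if Fin.castSucc x = 2 ∨ Fin.castSucc y = 2 then ρ else s)
        have hx : Fin.castSucc x ≠ 2 := (Fin.castSucc_lt_last x).ne
        have hy : Fin.castSucc y ≠ 2 := (Fin.castSucc_lt_last y).ne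
        simp only [hx, hy, or_self, if_false], fun i' x => by
        have hx : (⟨i', Fin.castSucc ∘ x⟩ : Σ i : L.I, Fin (L.n i) → Fin 3) ∉
            ({⟨i, t⟩} : Set (Σ i : L.I, Fin (L.n i) → Fin 3)) := by
          intro h
          obtain ⟨rfl, h'⟩ := Sigma.mk.inj_iff.1 (Set.mem_singleton_iff.1 h)
          have h2 : Fin.castSucc (x j') = 2 :=
            (congrFun (eq_of_heq h') j').trans (Function.update_of_ne hj' _ _)
          exact (Fin.castSucc_lt_last (x j')).ne h2
        exact (if_neg (Set.notMem_empty _)).trans (if_neg hx).symm⟩, Fin.last 2, hnew, hall⟩ φ hφ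
  have eq0 : ψ (0 : Fin 3) = χ (0 : Fin 3) :=
    (congrFun hψφ (0 : Fin 2)).trans (congrFun hχφ (0 : Fin 2)).symm
  have eq1 : ψ (1 : Fin 3) = χ (1 : Fin 3) :=
    (congrFun hψφ (1 : Fin 2)).trans (congrFun hχφ (1 : Fin 2)).symm
  let tup : U.M → Fin (L.n i) → U.M := fun a => Function.update (fun _ => ψ (2 : Fin 3)) j a
  have htup : ∀ p : Fin 3, tup (ψ p) = ψ ∘ (Function.update (fun _ => (2 : Fin 3)) j p) := by
    intro p
    exact (Function.comp_update ψ (fun _ => (2 : Fin 3)) j p).symm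
  have R1 : U.R i (tup (ψ (1 : Fin 3))) = 1 := by
    rw [htup, hψ.2.2 i]
    exact if_pos rfl
  have R0 : U.R i (tup (ψ (0 : Fin 3))) = 0 := by
    rw [htup, hψ.2.2 i]
    refine if_neg fun h => ?_
    obtain ⟨-, h'⟩ := Sigma.mk.inj_iff.1 (Set.mem_singleton_iff.1 h)
    have h01 : Function.update (fun _ => (2 : Fin 3)) j 0 j =
        Function.update (fun _ => (2 : Fin 3)) j 1 j := congrFun (eq_of_heq h') j
    rw [Function.update_self, Function.update_self] at h01
    exact absurd h01 (by decide)
  have d0 : U.d (χ (2 : Fin 3)) (χ (0 : Fin 3)) = s / 2 :=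
    (hχ.2.1 _ _).trans (show (if (2 : Fin 3) = 0 then (0 : ℝ) else
      if (2 : Fin 3) = 2 ∨ (0 : Fin 3) = 2 then s / 2 else s) = s / 2 by simp)
  have d1 : U.d (χ (2 : Fin 3)) (χ (1 : Fin 3)) = s / 2 :=
    (hχ.2.1 _ _).trans (show (if (2 : Fin 3) = 1 then (0 : ℝ) else
      if (2 : Fin 3) = 2 ∨ (1 : Fin 3) = 2 then s / 2 else s) = s / 2 by simp)
  have key : ∀ a b, U.d a b = s / 2 → |U.R i (tup a) - U.R i (tup b)| ≤ K * (s / 2) := by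
    intro a b hab
    have h := U.R_uc i j (tup a) (tup b) fun k hk => by
      simp only [tup, Function.update_of_ne hk]
    simp only [tup] at h ⊢
    rw [Function.update_self, Function.update_self, hab,
      hK _ ⟨by positivity, hus2⟩] at h
    exact h
  have k0 := key _ _ d0
  have k1 := key _ _ d1
  rw [← eq0, R0] at k0
  rw [← eq1, R1] at k1
  have := (abs_le.1 k0).2
  have := (abs_le.1 k1).1
  linarith

theorem Sig.exists_sum_le (L : Sig) {ε : ℝ} (hε : 0 < ε) :
    ∃ θ, 0 < θ ∧ θ ≤ ε ∧ ∀ i, ∑ j, L.u i j θ ≤ ε := by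
  have := L.finI
  have h1 : ∀ᶠ θ in nhdsWithin (0 : ℝ) (Set.Ioi 0), ∀ i, ∑ j, L.u i j θ ≤ ε := by
    refine Filter.eventually_all.2 fun i => ?_
    have h := tendsto_finsetSum Finset.univ fun j _ => L.u_lim i j
    rw [Finset.sum_const_zero] at h
    exact (h.eventually_lt_const hε).mono fun _ h => h.le
  obtain ⟨θ, h2, h3⟩ := (h1.and (Ioo_mem_nhdsGT hε)).exists
  exact ⟨θ, h3.1, h3.2.le, h2⟩

theorem Sig.exists_le_moduli (L : Sig) {δ : ℝ} (hδ : 0 < δ) :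
    ∃ η, 0 < η ∧ η ≤ δ ∧ ∀ i j, η ≤ L.u i j δ := by
  have := L.finI
  have h1 : ∀ᶠ η in nhdsWithin (0 : ℝ) (Set.Ioi 0), ∀ i j, η ≤ L.u i j δ :=
    Filter.eventually_all.2 fun i => Filter.eventually_all.2 fun j =>
      Filter.mem_of_superset (Ioo_mem_nhdsGT (L.u_pos i j δ hδ)) fun _ h => h.2.le
  obtain ⟨η, h2, h3⟩ := (h1.and (Ioo_mem_nhdsGT hδ)).exists
  exact ⟨η, h3.1, h3.2.le, h2⟩

/-- A point of a dense substructure `A` that approximately realizes the type of `z` over `C` can be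
moved by at most the error `δ` to a point realizing that type with an arbitrarily small error. -/
theorem exists_better_approximation {L : Sig} (hS : L.TruncSuperadditive) (hK : L.TruncLinear)
    {A Y C B : PreStr L} (hA : HasUrysohn A) {ι : A.M → Y.M} (hι : Emb A Y ι)
    (hdense : ∀ x : Y.M, ∀ ε : ℝ, 0 < ε → ∃ y : A.M, Y.d x (ι y) < ε)
    [Finite C.M] [Finite B.M] {e : C.M → B.M} (he : Emb C B e) {z : B.M}
    (hz : z ∉ Set.range e) (hall : ∀ b, b ∈ Set.range e ∨ b = z)
    {φ : C.M → Y.M} (hφ : Emb C Y φ) {g : Y.M → B.M → Y.M}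
    (hge : ∀ w s, g w (e s) = φ s) (hgz : ∀ w, g w z = w)
    {δ : ℝ} (hδ : 0 < δ) (y : A.M)
    (hyd : ∀ s, |Y.d (ι y) (φ s) - B.d z (e s)| ≤ δ)
    (hyR : ∀ i (q : Fin (L.n i) → B.M) j, |Y.R i (g (ι y) ∘ q) - B.R i q| ≤ L.u i j δ)
    {η : ℝ} (hη : 0 < η) :
    ∃ y', Y.d (ι y) (ι y') ≤ δ ∧ (∀ s, |Y.d (ι y') (φ s) - B.d z (e s)| ≤ η) ∧
      ∀ i (q : Fin (L.n i) → B.M), |Y.R i (g (ι y') ∘ q) - B.R i q| ≤ η := by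
  classical
  have hez : ∀ s, e s ≠ z := fun s h => hz ⟨s, h⟩
  have : Nonempty B.M := ⟨z⟩
  obtain ⟨N, hNY, hNB, hND, hNg, hNRY, hNRB⟩ := exists_amalgam hS hK Y B (g (ι y))
    (fun b => if b = z then δ else 0)
    (by
      intro b b'
      rcases hall b with ⟨s, rfl⟩ | rfl <;> rcases hall b' with ⟨s', rfl⟩ | rfl
      · simp [hge, hez, hφ.2.1, he.2.1]
      · simp only [hge, hgz, hez, if_false, if_true, zero_add]
        rw [Y.d_comm, B.d_comm]
        exact hyd s
      · simp only [hge, hgz, hez, if_false, if_true, add_zero]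
        exact hyd s'
      · simp [hgz, Y.d_self, B.d_self, hδ.le])
    (by
      intro i q
      by_cases h : ∃ j, q j = z
      · obtain ⟨j, hj⟩ := h
        refine ⟨j, ?_⟩
        rw [if_pos hj]
        exact hyR i q j
      · push Not at h
        choose c hc using fun j => (hall (q j)).resolve_right (h j)
        obtain rfl : e ∘ c = q := funext hc
        refine ⟨⟨0, L.n_pos i⟩, ?_⟩
        have e1 : g (ι y) ∘ e ∘ c = φ ∘ c := funext fun j => hge _ _
        rw [e1, hφ.2.2, he.2.2, sub_self, abs_zero]
        exact L.u_nonneg _ _ _)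
  obtain ⟨θ, hθ0, hθη, hθ⟩ := L.exists_sum_le (half_pos hη)
  choose x hx using fun s => hdense (φ s) θ hθ0
  let T : Set A.M := insert y (Set.range x)
  have hTfin : Finite T := ((Set.finite_range x).insert y).to_subtype
  let f : Option T → Y.M ⊕ B.M := fun o => o.elim (Sum.inr z) fun t => Sum.inl (ι t)
  have hpos : ∀ w, N.d (Sum.inl w) (Sum.inr z) ≠ 0 := by
    intro w h
    obtain ⟨b, hb⟩ := hND w z
    have h1 := Y.d_nonneg w (g (ι y) b)
    have h2 := B.d_nonneg b z
    by_cases hbz : b = z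
    · rw [if_pos hbz] at hb
      linarith
    · rw [if_neg hbz] at hb
      exact hbz (B.d_eq_zero b z (by linarith))
  have hf : ∀ a b, N.d (f a) (f b) = 0 → a = b := by
    rintro (_ | a) (_ | b) h
    · rfl
    · rw [N.d_comm] at h
      exact absurd h (hpos _)
    · exact absurd h (hpos _)
    · have h' : Y.d (ι a) (ι b) = 0 := (hNY _ _).symm.trans h
      rw [hι.2.1] at h'
      exact congrArg some (Subtype.ext (A.d_eq_zero _ _ h'))
  obtain ⟨ψ, hψ, hψT⟩ := hA (A.comap (Subtype.val : T → A.M) Subtype.val_injective)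
    (N.comap f hf) (some : T → Option T) hTfin
    ⟨⟨Option.some_injective T, fun a b => (hNY _ _).trans (hι.2.1 _ _),
      fun i t => (hNRY i (ι ∘ Subtype.val ∘ t)).trans (hι.2.2 i _)⟩,
      (none : Option T), fun ⟨t, ht⟩ => Option.some_ne_none t ht, by
        rintro (_ | t)
        · exact Or.inr rfl
        · exact Or.inl ⟨t, rfl⟩⟩
    Subtype.val ⟨Subtype.val_injective, fun _ _ => rfl, fun _ _ => rfl⟩
  change Option T → A.M at ψ
  have ψ_some : ∀ t : T, ψ (some t) = t := fun t => congrFun hψT t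
  have ψ_d : ∀ a b : Option T, Y.d (ι (ψ a)) (ι (ψ b)) = N.d (f a) (f b) := fun a b =>
    (hι.2.1 _ _).trans (hψ.2.1 a b)
  have ψ_R : ∀ i (p : Fin (L.n i) → Option T), Y.R i (ι ∘ ψ ∘ p) = N.R i (f ∘ p) := fun i p =>
    (hι.2.2 i _).trans (hψ.2.2 i p)
  have close : ∀ b, ∃ o : Option T, N.d (f o) (Sum.inr b) ≤ θ ∧
      Y.d (g (ι (ψ none)) b) (ι (ψ o)) ≤ θ := by
    intro b
    rcases hall b with ⟨s, rfl⟩ | rfl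
    · refine ⟨some ⟨x s, Set.mem_insert_of_mem _ ⟨s, rfl⟩⟩, ?_, ?_⟩
      · have h1 := N.d_triangle (Sum.inl (ι (x s))) (Sum.inl (φ s)) (Sum.inr (e s))
        have h2 := hNg (e s)
        rw [hge, if_neg (hez s)] at h2
        rw [hNY, Y.d_comm] at h1
        have h3 := hx s
        show N.d (Sum.inl (ι (x s))) _ ≤ θ
        linarith
      · rw [hge, ψ_some]
        exact (hx s).le
    · refine ⟨none, ?_, ?_⟩
      · rw [show f none = Sum.inr b from rfl, N.d_self]
        exact hθ0.le
      · rw [hgz, Y.d_self]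
        exact hθ0.le
  refine ⟨ψ none, ?_, fun s => ?_, fun i q => ?_⟩
  · have h := ψ_d (some ⟨y, Set.mem_insert _ _⟩) none
    rw [ψ_some] at h
    rw [h]
    have h2 := hNg z
    rw [hgz, if_pos rfl] at h2
    exact h2
  · obtain ⟨o, ho1, ho2⟩ := close (e s)
    rw [hge] at ho2
    have h1 := ψ_d none o
    rw [show f none = Sum.inr z from rfl] at h1
    have t1 := Y.d_triangle (ι (ψ none)) (ι (ψ o)) (φ s)
    have t2 := Y.d_triangle (ι (ψ none)) (φ s) (ι (ψ o))
    have t3 := N.d_triangle (Sum.inr z) (f o) (Sum.inr (e s))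
    have t4 := N.d_triangle (Sum.inr z) (Sum.inr (e s)) (f o)
    rw [Y.d_comm (ι (ψ o))] at t1
    rw [N.d_comm (Sum.inr (e s))] at t4
    rw [hNB] at t3 t4
    exact abs_le.2 ⟨by linarith, by linarith⟩
  · choose k hk1 hk2 using close
    have r1 := Y.toPseudo.abs_R_sub_le_sum i (g (ι (ψ none)) ∘ q) (ι ∘ ψ ∘ k ∘ q)
    have r2 := N.abs_R_sub_le_sum i (f ∘ k ∘ q) (Sum.inr ∘ q)
    have m1 : ∑ j, L.u i j (Y.d ((g (ι (ψ none)) ∘ q) j) ((ι ∘ ψ ∘ k ∘ q) j)) ≤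
        ∑ j, L.u i j θ := Finset.sum_le_sum fun j _ =>
      L.u_mono i j (Y.d_nonneg _ _) hθ0.le (hk2 (q j))
    have m2 : ∑ j, L.u i j (N.d ((f ∘ k ∘ q) j) ((Sum.inr ∘ q) j)) ≤ ∑ j, L.u i j θ :=
      Finset.sum_le_sum fun j _ => L.u_mono i j (N.d_nonneg _ _) hθ0.le (hk1 (q j))
    have r1' := r1.trans (m1.trans (hθ i))
    have r2' := r2.trans (m2.trans (hθ i))
    rw [hNRB, ← ψ_R] at r2'
    have := abs_sub_le (Y.R i (g (ι (ψ none)) ∘ q)) (Y.R i (ι ∘ ψ ∘ k ∘ q)) (B.R i q)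
    change |Y.R i _ - Y.R i _| ≤ _ at r1'
    linarith

/-- A sequence whose steps shrink geometrically converges in a complete pre-structure. -/
theorem PreStr.IsComplete.exists_limit {L : Sig} {Y : PreStr L} (hY : Y.IsComplete)
    (f : ℕ → Y.M) {c : ℝ} (hf : ∀ m, Y.d (f m) (f (m + 1)) ≤ c / 2 ^ m) :
    ∃ x, ∀ ε : ℝ, 0 < ε → ∃ N : ℕ, ∀ n ≥ N, Y.d (f n) x < ε := by
  have tail : ∀ N k, Y.d (f N) (f (N + k)) ≤ 2 * c / 2 ^ N - 2 * c / 2 ^ (N + k) := by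
    intro N k
    induction k with
    | zero => simp [Y.d_self]
    | succ k ih =>
      have h1 := Y.d_triangle (f N) (f (N + k)) (f (N + (k + 1)))
      have h2 := hf (N + k)
      have h3 : 2 * c / 2 ^ (N + k) - 2 * c / 2 ^ (N + (k + 1)) = c / 2 ^ (N + k) := by
        rw [← add_assoc, pow_succ]
        field_simp
        ring
      rw [← add_assoc] at h1 h3 ⊢
      linarith
  have hc : 0 ≤ c := by simpa using (Y.d_nonneg _ _).trans (hf 0)
  refine hY f fun ε hε => ?_
  obtain ⟨N, hN⟩ : ∃ N : ℕ, 2 * c / 2 ^ N < ε / 2 := by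
    have ht : Filter.Tendsto (fun m : ℕ => 2 * c / 2 ^ m) Filter.atTop (nhds 0) := by
      simpa [div_eq_mul_inv] using
        (tendsto_pow_atTop_nhds_zero_of_lt_one (by norm_num : (0 : ℝ) ≤ 2⁻¹)
          (by norm_num)).const_mul (2 * c)
    exact (ht.eventually_lt_const (half_pos hε)).exists
  have hlt : ∀ m ≥ N, Y.d (f N) (f m) < ε / 2 := by
    intro m hm
    obtain ⟨k, rfl⟩ := Nat.exists_eq_add_of_le hm
    have h1 := tail N k
    have h2 : 0 ≤ 2 * c / 2 ^ (N + k) := by positivity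
    linarith
  refine ⟨N, fun m hm n hn => ?_⟩
  have := Y.d_triangle (f m) (f N) (f n)
  rw [Y.d_comm (f m) (f N)] at this
  linarith [hlt m hm, hlt n hn]

/-- Theorem (paper Thm 4.12): let `L` be proper and let `A` be a continuous
`L`-pre-structure with the Urysohn property.  Then any continuous `L`-structure
`Abar` containing `A` as a dense substructure (i.e. any completion of `A`) has
the Urysohn property. -/
theorem stmt10 (L : Sig) (hL : L.Proper) (A Abar : PreStr L)
    (hA : HasUrysohn A)
    (ι : A.M → Abar.M) (hι : Emb A Abar ι)
    (hdense : ∀ x : Abar.M, ∀ ε : ℝ, 0 < ε → ∃ y : A.M, Abar.d x (ι y) < ε)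
    (hcomp : Abar.IsComplete) :
    HasUrysohn Abar := by
  intro C B e hfin hext φ hφ
  obtain ⟨he, z, hz, hall⟩ := hext
  have hS := hL.1.truncSuperadditive
  have hK := hA.truncLinear hL.1
  have hBfin : Finite B.M := by
    refine Set.finite_univ_iff.1 (((Set.finite_range e).insert z).subset fun b _ => ?_)
    rcases hall b with h | h
    · exact Set.mem_insert_of_mem _ h
    · exact Set.mem_insert_iff.2 (Or.inl h)
  have hez : ∀ s, e s ≠ z := fun s h => hz ⟨s, h⟩
  obtain ⟨g, hge, hgz⟩ : ∃ g : Abar.M → B.M → Abar.M,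
      (∀ w s, g w (e s) = φ s) ∧ ∀ w, g w z = w :=
    ⟨fun w => Function.extend e φ fun _ => w, fun w s => he.1.extend_apply _ _ s,
      fun w => Function.extend_apply' _ _ _ hz⟩
  obtain ⟨y₀⟩ : Nonempty A.M := by
    obtain ⟨φ₀, -⟩ := hA.exists_emb B 1 (fun _ => z) fun _ _ _ => Subsingleton.elim _ _
    exact ⟨φ₀ 0⟩
  obtain ⟨c, hcu, hcd, hc0⟩ := (hL.1.eventually_one_le.and
    ((Filter.eventually_all.2 fun s => Filter.eventually_ge_atTop
      |Abar.d (ι y₀) (φ s) - B.d z (e s)|).and (Filter.eventually_gt_atTop 0))).exists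
  let P : ℕ → A.M → Prop := fun m y =>
    (∀ s, |Abar.d (ι y) (φ s) - B.d z (e s)| ≤ c / 2 ^ m) ∧
      ∀ i (q : Fin (L.n i) → B.M) j,
        |Abar.R i (g (ι y) ∘ q) - B.R i q| ≤ L.u i j (c / 2 ^ m)
  have hP0 : P 0 y₀ := by
    simp only [P, pow_zero, div_one]
    exact ⟨hcd, fun i q j => (abs_sub_le_one (Abar.R_mem _ _) (B.R_mem _ _)).trans (hcu i j)⟩
  have hstep : ∀ m y, P m y → ∃ y', P (m + 1) y' ∧ Abar.d (ι y) (ι y') ≤ c / 2 ^ m := by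
    intro m y hy
    obtain ⟨η, hη, hη1, hη2⟩ := L.exists_le_moduli (δ := c / 2 ^ (m + 1)) (by positivity)
    obtain ⟨y', h1, h2, h3⟩ := exists_better_approximation hS hK hA hι hdense he hz hall hφ
      hge hgz (δ := c / 2 ^ m) (by positivity) y hy.1 hy.2 hη
    exact ⟨y', ⟨fun s => (h2 s).trans hη1, fun i q j => (h3 i q).trans (hη2 i j)⟩, h1⟩
  choose next hnextP hnextd using hstep
  let seq : (m : ℕ) → {y // P m y} := fun m =>
    Nat.rec ⟨y₀, hP0⟩ (fun m y => ⟨next m y.1 y.2, hnextP m y.1 y.2⟩) m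
  obtain ⟨w, hw⟩ := hcomp.exists_limit (fun m => ι (seq m).1) (c := c)
    fun m => hnextd m (seq m).1 (seq m).2
  have approx : ∀ θ, 0 < θ → ∃ m, Abar.d (ι (seq m).1) w ≤ θ ∧ c / 2 ^ m ≤ θ := by
    intro θ hθ
    obtain ⟨N, hN⟩ := hw θ hθ
    have ht : Filter.Tendsto (fun m : ℕ => c / 2 ^ m) Filter.atTop (nhds 0) := by
      simpa [div_eq_mul_inv] using
        (tendsto_pow_atTop_nhds_zero_of_lt_one (by norm_num : (0 : ℝ) ≤ 2⁻¹)
          (by norm_num)).const_mul c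
    obtain ⟨m, h1, h2⟩ :=
      ((ht.eventually_lt_const hθ).and (Filter.eventually_ge_atTop N)).exists
    exact ⟨m, (hN m h2).le, h1.le⟩
  have hwd : ∀ s, Abar.d w (φ s) = B.d z (e s) := by
    refine fun s => eq_of_abs_sub_le_all fun ε hε => ?_
    obtain ⟨m, h1, h2⟩ := approx (ε / 2) (half_pos hε)
    have h3 := abs_le.1 ((seq m).2.1 s)
    have t1 := Abar.d_triangle w (ι (seq m).1) (φ s)
    have t2 := Abar.d_triangle (ι (seq m).1) w (φ s)
    rw [Abar.d_comm w (ι (seq m).1)] at t1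
    exact abs_le.2 ⟨by linarith [h3.1], by linarith [h3.2]⟩
  have hgd : ∀ b b', Abar.d (g w b) (g w b') = B.d b b' := by
    intro b b'
    rcases hall b with ⟨s, rfl⟩ | rfl <;> rcases hall b' with ⟨s', rfl⟩ | rfl
    · rw [hge, hge, hφ.2.1, he.2.1]
    · rw [hge, hgz, Abar.d_comm, B.d_comm, hwd]
    · rw [hge, hgz, hwd]
    · rw [Abar.d_self, B.d_self]
  refine ⟨g w, ⟨fun b b' h => B.d_eq_zero _ _ ?_, hgd, fun i q => ?_⟩, funext fun s => hge w s⟩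
  · rw [← hgd, h, Abar.d_self]
  · refine eq_of_abs_sub_le_all fun ε hε => ?_
    obtain ⟨θ, hθ0, -, hθ⟩ := L.exists_sum_le (half_pos hε)
    obtain ⟨m, h1, h2⟩ := approx θ hθ0
    have r1 : |Abar.R i (g w ∘ q) - Abar.R i (g (ι (seq m).1) ∘ q)| ≤ ∑ j, L.u i j θ := by
      refine (Abar.toPseudo.abs_R_sub_le_sum i _ _).trans (Finset.sum_le_sum fun j _ =>
        L.u_mono i j (Abar.d_nonneg _ _) hθ0.le ?_)
      show Abar.d (g w (q j)) (g (ι (seq m).1) (q j)) ≤ θ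
      rcases hall (q j) with ⟨s, hs⟩ | hs
      · rw [← hs, hge, hge, Abar.d_self]
        exact hθ0.le
      · rw [hs, hgz, hgz, Abar.d_comm]
        exact h1
    let j₀ : Fin (L.n i) := ⟨0, L.n_pos i⟩
    have r2 := (seq m).2.2 i q j₀
    have r3 : L.u i j₀ (c / 2 ^ m) ≤ L.u i j₀ θ :=
      L.u_mono i j₀ (Set.mem_Ici.2 (by positivity)) hθ0.le h2
    have r4 : L.u i j₀ θ ≤ ∑ j, L.u i j θ :=
      Finset.single_le_sum (f := fun j => L.u i j θ) (fun j _ => L.u_nonneg i j θ)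
        (Finset.mem_univ j₀)
    have := abs_sub_le (Abar.R i (g w ∘ q)) (Abar.R i (g (ι (seq m).1) ∘ q)) (B.R i q)
    linarith [hθ i]

end ContLogic
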